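/- Let X = 𝕋² be the 2-dimensional torus and let G = {x ∈ X : x + x = 0} be the subgroup generated by all elements of order 2. Let α be a topological automorphism of 𝕋² such that both I+α and I−α are topological automorphisms of 𝕋². Let ξ₁ and ξ₂ be independent 𝕋²-valued random variables with distributions μ₁ and μ₂ whose characteristic functions do not vanish. If the joint distribution of (ξ₁+ξ₂, ξ₁+αξ₂) equals the joint distribution of (ξ₁+ξ₂, −(ξ₁+αξ₂)) (i.e., the conditional distribution of L₂ = ξ₁+αξ₂ given L₁ = ξ₁+ξ₂ is symmetric), then μⱼ = γⱼ ∗ ωⱼ for j = 1, 2, where γⱼ are Gaussian distributions on 𝕋², ωⱼ are probability measures supported in G, and moreover there exists a continuous homomorphism p : ℝ → 𝕋² with dense range such that each γⱼ is concentrated on a coset of the subgroup p(ℝ). -/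

import Mathlib

open MeasureTheory ProbabilityTheory

noncomputable section

/-- The circle group `𝕋 = ℝ/ℤ`. -/
abbrev Torus : Type := AddCircle (1 : ℝ)

/-- The 2-dimensional torus `𝕋² = 𝕋 × 𝕋`. -/
abbrev TwoTorus : Type := Torus × Torus

/-- The character group of `X`: continuous homomorphisms into the circle group. -/
abbrev CharGroup (X : Type*) [AddCommGroup X] [TopologicalSpace X] : Type _ :=
  ContinuousAddMonoidHom X Torus

/-- The characteristic function (Fourier transform) of a measure `μ` on `X`,
evaluated at the character `y`. -/
def charFun' {X : Type*} [AddCommGroup X] [TopologicalSpace X] [MeasurableSpace X]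
    (μ : Measure X) (y : CharGroup X) : ℂ :=
  ∫ x, (AddCircle.toCircle (y x) : ℂ) ∂μ

/-- A probability measure `γ` on `X` is Gaussian if its characteristic function has the form
`γ̂(y) = (x₀,y)·exp(−φ(y))` with `φ` continuous, nonnegative and quadratic. -/
def IsGaussianMeasure {X : Type*} [AddCommGroup X] [TopologicalSpace X] [MeasurableSpace X]
    (γ : Measure X) : Prop :=
  IsProbabilityMeasure γ ∧
  ∃ (x₀ : X) (φ : CharGroup X → ℝ), Continuous φ ∧ (∀ y, 0 ≤ φ y) ∧
    (∀ u v, φ (u + v) + φ (u - v) = 2 * (φ u + φ v)) ∧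
    ∀ y : CharGroup X, charFun' γ y = (AddCircle.toCircle (y x₀) : ℂ) * Complex.exp (-(φ y : ℂ))

section TorusHeyde

open Filter Topology Complex

/-- Every continuous endomorphism of the circle group is multiplication by an integer. -/
theorem Torus.exists_zsmul_of_hom (χ : CharGroup Torus) : ∃ n : ℤ, ∀ x, χ x = n • x := by
  let F : C(Torus, ℂ) :=
    ⟨fun x => (AddCircle.toCircle (χ x) : ℂ),
      continuous_subtype_val.comp (AddCircle.continuous_toCircle.comp χ.continuous_toFun)⟩
  have hF : ∃ n, fourierCoeff F n ≠ 0 := by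
    by_contra! h
    have hs : Summable (fourierCoeff F) := by
      rw [show fourierCoeff F = 0 from funext h]; exact summable_zero
    have h1 := has_pointwise_sum_fourier_series_of_summable hs 0
    simp only [h, zero_smul] at h1
    have h2 := h1.unique hasSum_zero
    simp [F] at h2
  obtain ⟨n, hn⟩ := hF
  refine ⟨n, fun s => ?_⟩
  let G : Torus → ℂ := fun x => (AddCircle.toCircle (χ x - n • x) : ℂ)
  have hG : fourierCoeff F n = ∫ t, G t ∂AddCircle.haarAddCircle := by
    unfold fourierCoeff
    refine integral_congr_ae (.of_forall fun t => ?_)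
    simp only [G, F, fourier_apply, sub_eq_add_neg, AddCircle.toCircle_add, Circle.coe_mul,
      smul_eq_mul, ContinuousMap.coe_mk, neg_smul]
    ring
  have h1 : ∫ t, G (t + s) ∂AddCircle.haarAddCircle = ∫ t, G t ∂AddCircle.haarAddCircle :=
    integral_add_right_eq_self G s
  have h2 : ∀ t, G (t + s) = G t * G s := fun t => by
    simp only [G, ← Circle.coe_mul, ← AddCircle.toCircle_add, map_add, smul_add]
    congr 2; abel
  simp only [h2] at h1
  rw [integral_mul_const, ← hG] at h1
  have h3 : G s = 1 := mul_left_cancel₀ hn (by rw [h1, mul_one])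
  have h4 : AddCircle.toCircle (χ s - n • s) = AddCircle.toCircle (0 : Torus) := by
    rw [AddCircle.toCircle_zero]; exact Circle.ext h3
  exact sub_eq_zero.1 (AddCircle.injective_toCircle one_ne_zero h4)

/-- The character `x ↦ v.1 • x.1 + v.2 • x.2` of the two-dimensional torus. -/
def torusChar (v : ℤ × ℤ) : CharGroup TwoTorus where
  toFun x := v.1 • x.1 + v.2 • x.2
  map_zero' := by simp
  map_add' x y := by simp only [Prod.fst_add, Prod.snd_add, smul_add]; abel
  continuous_toFun := by fun_prop

theorem torusChar_apply (v : ℤ × ℤ) (x : TwoTorus) :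
    torusChar v x = v.1 • x.1 + v.2 • x.2 := rfl

theorem torusChar_add_apply (v w : ℤ × ℤ) (x : TwoTorus) :
    torusChar (v + w) x = torusChar v x + torusChar w x := by
  simp only [torusChar_apply, Prod.fst_add, Prod.snd_add, add_smul]; abel

theorem torusChar_neg_apply (v : ℤ × ℤ) (x : TwoTorus) :
    torusChar (-v) x = -torusChar v x := by
  simp only [torusChar_apply, Prod.fst_neg, Prod.snd_neg, neg_smul]; abel

theorem torusChar_surjective : Function.Surjective torusChar := by
  intro y
  obtain ⟨m, hm⟩ := Torus.exists_zsmul_of_hom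
    (y.comp ⟨AddMonoidHom.inl Torus Torus, continuous_id.prodMk continuous_const⟩)
  obtain ⟨n, hn⟩ := Torus.exists_zsmul_of_hom
    (y.comp ⟨AddMonoidHom.inr Torus Torus, continuous_const.prodMk continuous_id⟩)
  refine ⟨(m, n), ?_⟩
  ext x
  have h1 : y (x.1, 0) = m • x.1 := hm x.1
  have h2 : y (0, x.2) = n • x.2 := hn x.2
  rw [torusChar_apply, ← h1, ← h2, ← map_add]
  simp

theorem torusChar_injective : Function.Injective torusChar := by
  have key : ∀ n : ℤ, (∀ x : Torus, n • x = 0) → n = 0 := by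
    intro n hn
    by_contra h0
    have h1 := hn ((1 / (2 * n : ℝ) : ℝ) : Torus)
    rw [← AddCircle.coe_zsmul, AddCircle.coe_eq_zero_iff] at h1
    obtain ⟨k, hk⟩ := h1
    have : (n : ℝ) ≠ 0 := by exact_mod_cast h0
    simp only [zsmul_eq_mul, mul_one] at hk
    field_simp at hk
    have : k * 2 = 1 := by exact_mod_cast hk
    omega
  intro v w h
  have h' : ∀ x, torusChar v x = torusChar w x := fun x => by rw [h]
  refine Prod.ext (sub_eq_zero.1 (key _ fun x => ?_)) (sub_eq_zero.1 (key _ fun x => ?_))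
  · have := h' (x, 0)
    simp only [torusChar_apply, smul_zero, add_zero] at this
    rw [sub_smul, this, sub_self]
  · have := h' (0, x)
    simp only [torusChar_apply, smul_zero, zero_add] at this
    rw [sub_smul, this, sub_self]

/-- The characteristic function of a measure on the two-dimensional torus as a function
on `ℤ × ℤ`. -/
def torusCharFun (μ : Measure TwoTorus) (v : ℤ × ℤ) : ℂ := charFun' μ (torusChar v)

theorem continuous_toCircle_char {X : Type*} [AddCommGroup X] [TopologicalSpace X]
    (y : CharGroup X) : Continuous fun x => (AddCircle.toCircle (y x) : ℂ) :=
  continuous_subtype_val.comp (AddCircle.continuous_toCircle.comp y.continuous_toFun)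

theorem integrable_toCircle_char (μ : Measure TwoTorus) [IsFiniteMeasure μ]
    (y : CharGroup TwoTorus) : Integrable (fun x => (AddCircle.toCircle (y x) : ℂ)) μ :=
  Integrable.of_bound (continuous_toCircle_char y).aestronglyMeasurable 1
    (.of_forall fun _ => (Circle.norm_coe _).le)

open BoundedContinuousFunction in
/-- A finite measure on the two-dimensional torus is determined by its characteristic function. -/
theorem ext_of_torusCharFun {μ ν : Measure TwoTorus} [IsFiniteMeasure μ] [IsFiniteMeasure ν]
    (h : ∀ v, torusCharFun μ v = torusCharFun ν v) : μ = ν := by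
  let e : ℤ × ℤ → (TwoTorus →ᵇ ℂ) := fun v =>
    BoundedContinuousFunction.mkOfCompact ⟨_, continuous_toCircle_char (torusChar v)⟩
  have he : ∀ v x, e v x = (AddCircle.toCircle (torusChar v x) : ℂ) := fun _ _ => rfl
  let A : StarSubalgebra ℂ (TwoTorus →ᵇ ℂ) :=
    { toSubalgebra := Algebra.adjoin ℂ (Set.range e)
      star_mem' := by
        change Algebra.adjoin ℂ (Set.range e) ≤ star (Algebra.adjoin ℂ (Set.range e))
        refine Algebra.adjoin_le ?_
        rintro - ⟨v, rfl⟩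
        refine Algebra.subset_adjoin ⟨-v, ?_⟩
        ext x
        simp [he, torusChar_neg_apply, AddCircle.toCircle_neg, ← Circle.coe_inv_eq_conj] }
  have hA : Subalgebra.toSubmodule A.toSubalgebra = Submodule.span ℂ (Set.range e) := by
    apply Algebra.adjoin_eq_span_of_subset
    refine Set.Subset.trans ?_ Submodule.subset_span
    intro x hx
    refine Submonoid.closure_induction (fun _ => id) ⟨0, ?_⟩ ?_ hx
    · ext x; simp [he, torusChar_apply]
    · rintro - - - - ⟨m, rfl⟩ ⟨n, rfl⟩
      refine ⟨m + n, ?_⟩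
      ext x
      simp [he, torusChar_add_apply, AddCircle.toCircle_add]
  refine ext_of_forall_mem_subalgebra_integral_eq_of_polish (A := A) (𝕜 := ℂ) ?_ ?_
  · intro x y hxy
    have hmem : ∀ v, e v ∈ A := fun v => Algebra.subset_adjoin ⟨v, rfl⟩
    by_contra! hcon
    have h1 : ∀ v, e v x = e v y := fun v => hcon _ ⟨_, ⟨e v, hmem v, rfl⟩, rfl⟩
    have h2 : ∀ v, torusChar v x = torusChar v y := fun v =>
      AddCircle.injective_toCircle one_ne_zero (Circle.ext (by rw [← he, ← he, h1]))
    have h3 := h2 (1, 0)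
    have h4 := h2 (0, 1)
    simp [torusChar_apply] at h3 h4
    exact hxy (Prod.ext h3 h4)
  · intro g hg
    have hg' : g ∈ Submodule.span ℂ (Set.range e) := by rw [← hA]; exact hg
    induction hg' using Submodule.span_induction with
    | mem x hx => obtain ⟨v, rfl⟩ := hx; exact h v
    | zero => simp
    | add x y hx hy h1 h2 =>
      have h1 := h1 (by rw [← hA] at hx; exact hx)
      have h2 := h2 (by rw [← hA] at hy; exact hy)
      simp only [BoundedContinuousFunction.coe_add, Pi.add_apply]
      rw [integral_add (x.integrable μ) (y.integrable μ),
        integral_add (x.integrable ν) (y.integrable ν), h1, h2]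
    | smul a x hx h1 =>
      have h1 := h1 (by rw [← hA] at hx; exact hx)
      simp only [BoundedContinuousFunction.coe_smul]
      rw [integral_smul, integral_smul, h1]

theorem torusCharFun_conv (μ ν : Measure TwoTorus) [IsFiniteMeasure μ] [IsFiniteMeasure ν]
    (v : ℤ × ℤ) : torusCharFun (μ ∗ ν) v = torusCharFun μ v * torusCharFun ν v := by
  unfold torusCharFun charFun'
  rw [integral_conv (integrable_toCircle_char _ _)]
  simp only [map_add, AddCircle.toCircle_add, Circle.coe_mul, integral_const_mul,
    integral_mul_const]

theorem torusCharFun_neg (μ : Measure TwoTorus) (v : ℤ × ℤ) :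
    torusCharFun μ (-v) = (starRingEnd ℂ) (torusCharFun μ v) := by
  unfold torusCharFun charFun'
  rw [← integral_conj]
  simp [torusChar_neg_apply, AddCircle.toCircle_neg, ← Circle.coe_inv_eq_conj]

theorem torusCharFun_zero (μ : Measure TwoTorus) [IsProbabilityMeasure μ] :
    torusCharFun μ 0 = 1 := by
  simp [torusCharFun, charFun', torusChar_apply]

theorem norm_torusCharFun_le_one (μ : Measure TwoTorus) [IsProbabilityMeasure μ] (v : ℤ × ℤ) :
    ‖torusCharFun μ v‖ ≤ 1 := by
  unfold torusCharFun charFun'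
  refine (norm_integral_le_integral_norm _).trans ?_
  simp only [Circle.norm_coe]
  simp

theorem continuous_charFun' (μ : Measure TwoTorus) [IsFiniteMeasure μ] :
    Continuous (charFun' μ) := by
  have : FirstCountableTopology (CharGroup TwoTorus) :=
    (ContinuousAddMonoidHom.isInducing_toContinuousMap TwoTorus Torus).firstCountableTopology
  refine continuous_of_dominated (bound := fun _ => 1)
    (fun y => (continuous_toCircle_char y).aestronglyMeasurable)
    (fun y => .of_forall fun _ => (Circle.norm_coe _).le)
    (integrable_const _) (.of_forall fun x => ?_)
  exact continuous_subtype_val.comp (AddCircle.continuous_toCircle.comp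
    (continuous_eval_const x))

/-- Solutions of the Heyde functional equation have vanishing third differences
`Δ_k Δ_l Δ_{2n}`. -/
theorem heyde_equation_third_difference {Y M : Type*} [AddCommGroup Y] [AddCommGroup M]
    (A : Y → Y) (hA : ∀ u v, A (u + v) = A u + A v)
    (hp : ∀ y, ∃ z, z + A z = y) (hm : ∀ y, ∃ z, z - A z = y) (f g : Y → M)
    (h : ∀ u v, f (u + v) + g (u + A v) = f (u - v) + g (u - A v)) (k l n : Y) :
    f (k + l + (n + n)) + f k + f l + f (n + n) =
      f (k + l) + f (k + (n + n)) + f (l + (n + n)) + f 0 := by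
  obtain ⟨K, rfl⟩ := hm k
  obtain ⟨L, rfl⟩ := hp l
  set P := A K
  set Q := A L
  set R := A n
  have e100 : f (K - P) + g 0 = f (-P - K) + g (-P - P) := by
    convert h (-P) K using 3 <;> abel
  have e010 : f (L + Q) + g (Q + Q) = f (Q - L) + g 0 := by
    convert h Q L using 3 <;> abel
  have e001 : f (n + n) + g (n + R) = f 0 + g (n - R) := by
    convert h n n using 3; abel
  have e110 : f (K - P + (L + Q)) + g (Q + Q) = f (-P - K + (Q - L)) + g (-P - P) := by
    convert h (-P + Q) (K + L) using 3 <;> first | (rw [hA]; abel) | abel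
  have e101 : f (K - P + (n + n)) + g (n + R) = f (-P - K) + g (-P - P + (n - R)) := by
    convert h (-P + n) (K + n) using 3 <;> first | (rw [hA]; abel) | abel
  have e011 : f (L + Q + (n + n)) + g (Q + Q + (n + R)) = f (Q - L) + g (n - R) := by
    convert h (Q + n) (L + n) using 3 <;> first | (rw [hA]; abel) | abel
  have e111 : f (K - P + (L + Q) + (n + n)) + g (Q + Q + (n + R)) =
      f (-P - K + (Q - L)) + g (-P - P + (n - R)) := by
    convert h (-P + Q + n) (K + L + n) using 3 <;> first | (rw [hA, hA]; abel) | abel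
  linear_combination (norm := abel) e111 - e110 - e101 - e011 + e100 + e010 + e001

/-- A nowhere vanishing Hermitian function on `ℤ × ℤ` that is normalized, bounded by one and whose
multiplicative third differences `Δ_k Δ_l Δ_{2n}` are trivial. -/
structure IsHeydeSolution (f : ℤ × ℤ → ℂ) : Prop where
  ne_zero : ∀ v, f v ≠ 0
  map_zero : f 0 = 1
  map_neg : ∀ v, f (-v) = (starRingEnd ℂ) (f v)
  norm_le_one : ∀ v, ‖f v‖ ≤ 1
  third_difference : ∀ k l n, f (k + l + (n + n)) * f k * f l * f (n + n) =
    f (k + l) * f (k + (n + n)) * f (l + (n + n))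

/-- The defect of multiplicativity `f (2h + k) / (f (2h) f k)`. -/
def doublingDefect (f : ℤ × ℤ → ℂ) (h k : ℤ × ℤ) : ℂ := f (h + h + k) / (f (h + h) * f k)

namespace IsHeydeSolution

variable {f g : ℤ × ℤ → ℂ}

theorem doublingDefect_ne_zero (hf : IsHeydeSolution f) (h k : ℤ × ℤ) :
    doublingDefect f h k ≠ 0 :=
  div_ne_zero (hf.ne_zero _) (mul_ne_zero (hf.ne_zero _) (hf.ne_zero _))

theorem apply_add (hf : IsHeydeSolution f) (h k : ℤ × ℤ) :
    f (h + h + k) = f (h + h) * f k * doublingDefect f h k := by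
  have h1 := hf.ne_zero (h + h)
  have h2 := hf.ne_zero k
  unfold doublingDefect
  field_simp

theorem doublingDefect_add_right (hf : IsHeydeSolution f) (h k l : ℤ × ℤ) :
    doublingDefect f h (k + l) = doublingDefect f h k * doublingDefect f h l := by
  have h1 := hf.ne_zero (h + h)
  have h2 := hf.ne_zero k
  have h3 := hf.ne_zero l
  have h4 := hf.ne_zero (k + l)
  have h5 := hf.third_difference k l h
  unfold doublingDefect
  rw [add_comm (h + h), add_comm (h + h), add_comm (h + h)]
  field_simp
  linear_combination h5

theorem doublingDefect_add_left (hf : IsHeydeSolution f) (h h' k : ℤ × ℤ) :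
    doublingDefect f (h + h') k = doublingDefect f h k * doublingDefect f h' k := by
  have h1 := hf.ne_zero (h + h)
  have h2 := hf.ne_zero (h' + h')
  have h3 := hf.ne_zero k
  have h4 := hf.ne_zero (h + h + (h' + h'))
  have h5 := hf.third_difference (h + h) k h'
  unfold doublingDefect
  rw [show h + h' + (h + h') = h + h + (h' + h') by abel, add_comm (h' + h') k,
    show h + h + (h' + h') + k = h + h + k + (h' + h') by abel]
  field_simp
  linear_combination h5

theorem conj_doublingDefect (hf : IsHeydeSolution f) (h k : ℤ × ℤ) :
    (starRingEnd ℂ) (doublingDefect f h k) = doublingDefect f h k := by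
  have h0 : ∀ k, doublingDefect f 0 k = 1 := fun k => by
    simp [doublingDefect, hf.map_zero, hf.ne_zero k]
  have h0' : ∀ h, doublingDefect f h 0 = 1 := fun k => by
    simp [doublingDefect, hf.map_zero, hf.ne_zero]
  have h1 : (starRingEnd ℂ) (doublingDefect f h k) = doublingDefect f (-h) (-k) := by
    unfold doublingDefect
    rw [show -h + -h + -k = -(h + h + k) by abel, show -h + -h = -(h + h) by abel]
    simp only [hf.map_neg, map_div₀, map_mul]
  have h2 := hf.doublingDefect_add_left h (-h) (-k)
  have h3 := hf.doublingDefect_add_right h k (-k)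
  rw [add_neg_cancel, h0] at h2
  rw [add_neg_cancel, h0'] at h3
  rw [h1]
  refine mul_left_cancel₀ (hf.doublingDefect_ne_zero h (-k)) ?_
  rw [← h2, h3, mul_comm]

end IsHeydeSolution

/-- The form `(h, k) ↦ -log |f (2h + k) / (f (2h) f k)|`. -/
def logDefect (f : ℤ × ℤ → ℂ) (h k : ℤ × ℤ) : ℝ := -Real.log ‖doublingDefect f h k‖

namespace IsHeydeSolution

variable {f g : ℤ × ℤ → ℂ}

theorem logDefect_add_right (hf : IsHeydeSolution f) (h k l : ℤ × ℤ) :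
    logDefect f h (k + l) = logDefect f h k + logDefect f h l := by
  unfold logDefect
  rw [hf.doublingDefect_add_right, norm_mul, Real.log_mul
    (norm_ne_zero_iff.2 (hf.doublingDefect_ne_zero _ _))
    (norm_ne_zero_iff.2 (hf.doublingDefect_ne_zero _ _))]
  ring

theorem logDefect_add_left (hf : IsHeydeSolution f) (h h' k : ℤ × ℤ) :
    logDefect f (h + h') k = logDefect f h k + logDefect f h' k := by
  unfold logDefect
  rw [hf.doublingDefect_add_left, norm_mul, Real.log_mul
    (norm_ne_zero_iff.2 (hf.doublingDefect_ne_zero _ _))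
    (norm_ne_zero_iff.2 (hf.doublingDefect_ne_zero _ _))]
  ring

theorem log_norm_apply_add (hf : IsHeydeSolution f) (h k : ℤ × ℤ) :
    Real.log ‖f (h + h + k)‖ = Real.log ‖f (h + h)‖ + Real.log ‖f k‖ - logDefect f h k := by
  have h1 := norm_ne_zero_iff.2 (hf.ne_zero (h + h))
  have h2 := norm_ne_zero_iff.2 (hf.ne_zero k)
  have h3 := norm_ne_zero_iff.2 (hf.doublingDefect_ne_zero h k)
  rw [hf.apply_add, norm_mul, norm_mul, Real.log_mul (mul_ne_zero h1 h2) h3, Real.log_mul h1 h2,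
    logDefect]
  ring

theorem logDefect_neg_left (hf : IsHeydeSolution f) (h k : ℤ × ℤ) :
    logDefect f (-h) k = -logDefect f h k := by
  have h0 := hf.logDefect_add_left 0 0 k
  have h1 := hf.logDefect_add_left h (-h) k
  rw [add_neg_cancel] at h1
  rw [add_zero] at h0
  linarith

theorem logDefect_neg_right (hf : IsHeydeSolution f) (h k : ℤ × ℤ) :
    logDefect f h (-k) = -logDefect f h k := by
  have h0 := hf.logDefect_add_right h 0 0
  have h1 := hf.logDefect_add_right h k (-k)
  rw [add_neg_cancel] at h1
  rw [add_zero] at h0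
  linarith

theorem log_norm_double (hf : IsHeydeSolution f) (k : ℤ × ℤ) :
    Real.log ‖f (k + k)‖ = -logDefect f k k := by
  have h1 := hf.log_norm_apply_add (-k) k
  rw [show -k + -k + k = -k by abel, show -k + -k = -(k + k) by abel, hf.map_neg, hf.map_neg,
    RCLike.norm_conj, RCLike.norm_conj, hf.logDefect_neg_left] at h1
  linarith

theorem logDefect_self_nonneg (hf : IsHeydeSolution f) (k : ℤ × ℤ) : 0 ≤ logDefect f k k := by
  have h1 := hf.log_norm_double k
  have h2 := Real.log_nonpos (norm_nonneg _) (hf.norm_le_one (k + k))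
  linarith

theorem logDefect_comm (hf : IsHeydeSolution f) (h k : ℤ × ℤ) :
    logDefect f h k = logDefect f k h := by
  have h1 := hf.log_norm_apply_add h (k + k)
  rw [show h + h + (k + k) = h + k + (h + k) by abel, hf.log_norm_double, hf.log_norm_double,
    hf.log_norm_double] at h1
  simp only [hf.logDefect_add_left, hf.logDefect_add_right] at h1
  linarith

theorem logDefect_eq_neg (hf : IsHeydeSolution f) (hg : IsHeydeSolution g) (A : ℤ × ℤ → ℤ × ℤ)
    (h : ∀ u v, f (u + v) * g (u + A v) = f (u - v) * g (u - A v)) (u v : ℤ × ℤ) :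
    logDefect f v u = -logDefect g (A v) u := by
  have key : ∀ u v, logDefect f v v + logDefect f v u + logDefect g (A v) v
      + logDefect g (A v) u = 0 := by
    intro u v
    have h1 := h (u + v) v
    rw [show u + v + v = v + v + u by abel, show u + v - v = u by abel,
      show u + v + A v = A v + A v + (u + v - A v) by abel] at h1
    have h2 := congrArg (fun z : ℂ => Real.log ‖z‖) h1
    simp only [norm_mul] at h2
    rw [Real.log_mul (norm_ne_zero_iff.2 (hf.ne_zero _)) (norm_ne_zero_iff.2 (hg.ne_zero _)),
      Real.log_mul (norm_ne_zero_iff.2 (hf.ne_zero _)) (norm_ne_zero_iff.2 (hg.ne_zero _)),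
      hf.log_norm_apply_add, hg.log_norm_apply_add, hf.log_norm_double, hg.log_norm_double] at h2
    have h3 : logDefect g (A v) (u + v - A v) =
        logDefect g (A v) u + logDefect g (A v) v - logDefect g (A v) (A v) := by
      rw [sub_eq_add_neg, hg.logDefect_add_right, hg.logDefect_add_right,
        hg.logDefect_neg_right, ← sub_eq_add_neg]
    linarith
  have h1 := key u v
  have h2 := key 0 v
  have h3 := hf.logDefect_add_right v 0 0
  have h4 := hg.logDefect_add_right (A v) 0 0
  rw [add_zero] at h3 h4
  linarith

end IsHeydeSolution

theorem map_int_prod_eq (φ : ℤ × ℤ → ℝ) (h : ∀ u v, φ (u + v) = φ u + φ v) (v : ℤ × ℤ) :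
    φ v = v.1 * φ (1, 0) + v.2 * φ (0, 1) := by
  let Φ : ℤ × ℤ →+ ℝ := AddMonoidHom.mk' φ h
  have h1 : v = v.1 • ((1, 0) : ℤ × ℤ) + v.2 • ((0, 1) : ℤ × ℤ) := by
    ext <;> simp
  have h2 : Φ v = v.1 • Φ (1, 0) + v.2 • Φ (0, 1) := by
    conv_lhs => rw [h1]
    rw [map_add, map_zsmul, map_zsmul]
  simpa [Φ] using h2

theorem sq_le_mul_of_int_quadratic_nonneg {p q r : ℝ}
    (h : ∀ m n : ℤ, 0 ≤ p * m ^ 2 + 2 * q * m * n + r * n ^ 2) : q ^ 2 ≤ p * r := by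
  have hrat : ∀ x : ℚ, 0 ≤ p * ((x : ℝ) * x) + 2 * q * x + r := by
    intro x
    have h1 := h x.num x.den
    have h2 : (0 : ℝ) < x.den := by exact_mod_cast x.den_pos
    have h3 : (x : ℝ) = x.num / x.den := by exact_mod_cast (Rat.num_div_den x).symm
    rw [h3]
    have h4 : p * ((x.num : ℝ) / x.den * (x.num / x.den)) + 2 * q * (x.num / x.den) + r =
        (p * (x.num : ℝ) ^ 2 + 2 * q * x.num * (x.den : ℤ) + r * (x.den : ℤ) ^ 2) / x.den ^ 2 := by
      push_cast
      field_simp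
    rw [h4]
    exact div_nonneg h1 (by positivity)
  have hreal : ∀ x : ℝ, 0 ≤ p * (x * x) + 2 * q * x + r :=
    fun x => isClosed_property Rat.denseRange_cast
      (p := fun x : ℝ => 0 ≤ p * (x * x) + 2 * q * x + r)
      (isClosed_le continuous_const (by fun_prop)) hrat x
  have h1 := discrim_le_zero hreal
  unfold discrim at h1
  linarith

/-- A matrix over `ℤ` of determinant `-1` and trace `±1` that intertwines, up to sign, two positive
semidefinite binary quadratic forms forces them to be multiples of the square of a common linear
form of irrational slope. -/
theorem exists_irrational_slope {a b c d : ℤ} (hdet : a * d - b * c = -1) (htr : (a + d) ^ 2 = 1)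
    {p q r p' q' r' : ℝ} (hp : p' = -(a * p + c * q)) (hq : q' = -(a * q + c * r))
    (hq' : q' = -(b * p + d * q)) (hr : r' = -(b * q + d * r))
    (h : ∀ m n : ℤ, 0 ≤ p * m ^ 2 + 2 * q * m * n + r * n ^ 2)
    (h' : ∀ m n : ℤ, 0 ≤ p' * m ^ 2 + 2 * q' * m * n + r' * n ^ 2) :
    ∃ τ s s' : ℝ, Irrational τ ∧ 0 ≤ s ∧ 0 ≤ s' ∧ p = s ∧ q = s * τ ∧ r = s * τ ^ 2 ∧
      p' = s' ∧ q' = s' * τ ∧ r' = s' * τ ^ 2 := by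
  have hdetR : (a * d - b * c : ℝ) = -1 := by exact_mod_cast hdet
  have htrR : (a + d : ℝ) ^ 2 = 1 := by exact_mod_cast htr
  have hp0 : 0 ≤ p := by simpa using h 1 0
  have hp0' : 0 ≤ p' := by simpa using h' 1 0
  have hD := sq_le_mul_of_int_quadratic_nonneg h
  have hD' := sq_le_mul_of_int_quadratic_nonneg h'
  have hc : c ≠ 0 := by
    rintro rfl
    have had : a * d = -1 := by linarith
    have h0 : a + d = 0 := by
      rcases Int.eq_one_or_neg_one_of_mul_eq_neg_one had with rfl | rfl <;> omega
    rw [h0] at htr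
    norm_num at htr
  have hDD : p' * r' - q' ^ 2 = -(p * r - q ^ 2) := by
    rw [sq q']
    nth_rewrite 2 [hq']
    rw [hp, hq, hr]
    linear_combination (p * r - q ^ 2) * hdetR
  have hpr : p * r = q ^ 2 := by linarith
  rcases eq_or_ne p 0 with rfl | hpne
  · have hq0 : q = 0 := by
      have : q ^ 2 = 0 := by rw [← hpr]; ring
      simpa using this
    have hr0 : r = 0 := by
      have : (c : ℝ) * r = 0 := by rw [hq0] at hq hq'; linarith
      exact (mul_eq_zero.1 this).resolve_left (by exact_mod_cast hc)
    refine ⟨√2, 0, 0, irrational_sqrt_two, le_rfl, le_rfl, rfl, ?_, ?_, ?_, ?_, ?_⟩ <;>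
      simp [*]
  · obtain ⟨σ, rfl⟩ : ∃ σ, q = p * σ := ⟨q / p, by field_simp⟩
    have hr' : r = p * σ ^ 2 := mul_left_cancel₀ hpne (by rw [hpr]; ring)
    have hσ : c * σ ^ 2 + a * σ = b + d * σ := by
      refine mul_left_cancel₀ hpne ?_
      rw [hr'] at hq
      linear_combination hq - hq'
    refine ⟨σ, p, p', ?_, hp0, hp0', rfl, rfl, hr', rfl, ?_, ?_⟩
    · rintro ⟨x, rfl⟩
      have h5 : ((2 * (a + c * x) - (a + d) : ℚ)) ^ 2 = 5 := by
        have : ((2 * (a + c * x) - (a + d) : ℝ)) ^ 2 = 5 := by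
          linear_combination 4 * (c : ℝ) * hσ + htrR - 4 * hdetR
        exact_mod_cast this
      have h6 : Irrational (√(5 : ℕ)) := Nat.Prime.irrational_sqrt (by norm_num)
      refine h6 ⟨|2 * (a + c * x) - (a + d)|, ?_⟩
      rw [Rat.cast_abs, ← Real.sqrt_sq_eq_abs, ← Rat.cast_pow, h5]
      norm_num
    · rw [hq, hp, hr']; ring
    · rw [hr, hp, hr']; linear_combination (p * σ) * hσ

/-- For irrational `τ`, every coset of `2ℤ²` contains points on which `v.1 + v.2 τ` is small. -/
theorem exists_abs_linearForm_lt {τ : ℝ} (hτ : Irrational τ) (c : ℤ × ℤ) {ε : ℝ} (hε : 0 < ε) :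
    ∃ h : ℤ × ℤ, |((c + (h + h)).1 : ℝ) + (c + (h + h)).2 * τ| < ε := by
  have hd : Dense (AddSubgroup.closure {τ, 1} : Set ℝ) :=
    dense_addSubgroupClosure_pair_iff.2 (by simpa using hτ)
  obtain ⟨x, hx, hxε⟩ := Metric.dense_iff.1 hd (-(c.1 + c.2 * τ) / 2) (ε / 2) (by positivity)
  obtain ⟨n, m, rfl⟩ := AddSubgroup.mem_closure_pair.1 hxε
  refine ⟨(m, n), ?_⟩
  rw [Metric.mem_ball, Real.dist_eq] at hx
  have : ((c + ((m, n) + (m, n))).1 : ℝ) + (c + ((m, n) + (m, n))).2 * τ =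
      2 * (n • τ + m • (1 : ℝ) - -(c.1 + c.2 * τ) / 2) := by
    simp
    ring
  rw [this, abs_mul, abs_two]
  linarith

theorem denseRange_line {τ : ℝ} (hτ : Irrational τ) :
    DenseRange fun t : ℝ => (((t : ℝ) : Torus), ((t * τ : ℝ) : Torus)) := by
  have hd : Dense (AddSubgroup.closure {τ, 1} : Set ℝ) :=
    dense_addSubgroupClosure_pair_iff.2 (by simpa using hτ)
  have hfst : ∀ x y : ℝ, ((x : Torus), (y : Torus)) ∈
      closure (Set.range fun t : ℝ => (((t : ℝ) : Torus), ((t * τ : ℝ) : Torus))) := by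
    intro x y
    let F : ℝ → TwoTorus := fun s => ((x : Torus), ((x * τ + s : ℝ) : Torus))
    have hF : Continuous F := by
      refine continuous_const.prodMk ?_
      exact (AddCircle.continuous_mk' 1).comp (continuous_const.add continuous_id)
    have h1 : F (y - x * τ) ∈ closure (F '' (AddSubgroup.closure {τ, 1} : Set ℝ)) :=
      image_closure_subset_closure_image hF ⟨_, hd _, rfl⟩
    simp only [F, add_sub_cancel] at h1
    refine closure_mono ?_ h1
    rintro - ⟨s, hs, rfl⟩
    obtain ⟨n, m, rfl⟩ := AddSubgroup.mem_closure_pair.1 hs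
    refine ⟨x + n, Prod.ext ?_ ?_⟩
    · simp
    · simp [add_mul]
  rintro ⟨x, y⟩
  induction x using QuotientAddGroup.induction_on with | _ x
  induction y using QuotientAddGroup.induction_on with | _ y
  exact hfst x y

/-- The one-parameter subgroup `t ↦ (t, t τ)` of the two-dimensional torus. -/
def torusLine (τ : ℝ) : ℝ →+ TwoTorus where
  toFun t := ((t : Torus), ((t * τ : ℝ) : Torus))
  map_zero' := by simp
  map_add' x y := by simp [add_mul]

theorem torusLine_apply (τ t : ℝ) : torusLine τ t = ((t : Torus), ((t * τ : ℝ) : Torus)) := rfl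

theorem continuous_torusLine (τ : ℝ) : Continuous (torusLine τ) :=
  (AddCircle.continuous_mk' 1).prodMk
    ((AddCircle.continuous_mk' 1).comp (continuous_id.mul continuous_const))

/-- The value `v.1 + v.2 τ` of the linear form of slope `τ`. -/
def slopeForm (τ : ℝ) (v : ℤ × ℤ) : ℝ := v.1 + v.2 * τ

theorem slopeForm_add (τ : ℝ) (u v : ℤ × ℤ) :
    slopeForm τ (u + v) = slopeForm τ u + slopeForm τ v := by
  simp [slopeForm]; ring

theorem slopeForm_neg (τ : ℝ) (v : ℤ × ℤ) : slopeForm τ (-v) = -slopeForm τ v := by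
  simp [slopeForm]; ring

theorem torusChar_torusLine (τ t : ℝ) (v : ℤ × ℤ) :
    torusChar v (torusLine τ t) = ((slopeForm τ v * t : ℝ) : Torus) := by
  rw [torusChar_apply, torusLine_apply, ← AddCircle.coe_zsmul, ← AddCircle.coe_zsmul,
    ← AddCircle.coe_add]
  congr 1
  simp [slopeForm]
  ring

/-- The image of a centred Gaussian distribution on the line under `t ↦ x + (t, t τ)`. -/
def gaussianTorusLine (τ : ℝ) (x : TwoTorus) (σ : NNReal) : Measure TwoTorus :=
  (gaussianReal 0 σ).map fun t => x + torusLine τ t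

theorem measurable_add_torusLine (τ : ℝ) (x : TwoTorus) :
    Measurable fun t => x + torusLine τ t :=
  (continuous_const.add (continuous_torusLine τ)).measurable

instance (τ : ℝ) (x : TwoTorus) (σ : NNReal) : IsProbabilityMeasure (gaussianTorusLine τ x σ) :=
  Measure.isProbabilityMeasure_map (measurable_add_torusLine τ x).aemeasurable

theorem torusCharFun_gaussianTorusLine (τ : ℝ) (x : TwoTorus) (σ : NNReal) (v : ℤ × ℤ) :
    torusCharFun (gaussianTorusLine τ x σ) v = (AddCircle.toCircle (torusChar v x) : ℂ) *
      Complex.exp (-((2 * Real.pi ^ 2 * σ * slopeForm τ v ^ 2 : ℝ) : ℂ)) := by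
  unfold torusCharFun charFun' gaussianTorusLine
  rw [integral_map (measurable_add_torusLine τ x).aemeasurable
    (continuous_toCircle_char _).aestronglyMeasurable]
  simp only [map_add, AddCircle.toCircle_add, Circle.coe_mul, integral_const_mul,
    torusChar_torusLine, AddCircle.toCircle_apply_mk, Circle.coe_exp]
  congr 1
  have h := charFun_gaussianReal (μ := 0) (v := σ) (2 * Real.pi * slopeForm τ v)
  rw [charFun_apply_real] at h
  have h2 : ∀ t : ℝ, Complex.exp (((2 * Real.pi / 1 * (slopeForm τ v * t) : ℝ) : ℂ) * I) =
      Complex.exp (((2 * Real.pi * slopeForm τ v : ℝ) : ℂ) * t * I) := fun t => by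
    congr 2; push_cast; ring
  simp only [h2]
  rw [h]
  congr 1
  push_cast
  ring

theorem isGaussianMeasure_gaussianTorusLine (τ : ℝ) (x : TwoTorus) (σ : NNReal) :
    IsGaussianMeasure (gaussianTorusLine τ x σ) := by
  have hφ : ∀ v, -Real.log ‖charFun' (gaussianTorusLine τ x σ) (torusChar v)‖ =
      2 * Real.pi ^ 2 * σ * slopeForm τ v ^ 2 := by
    intro v
    have h := torusCharFun_gaussianTorusLine τ x σ v
    unfold torusCharFun at h
    rw [h, norm_mul, Circle.norm_coe, one_mul, Complex.norm_exp, Real.log_exp, ← ofReal_neg,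
      ofReal_re, neg_neg]
  refine ⟨inferInstance, x, fun y => -Real.log ‖charFun' (gaussianTorusLine τ x σ) y‖,
    ?_, ?_, ?_, ?_⟩
  · refine ((continuous_charFun' _).norm.log fun y => ?_).neg
    obtain ⟨v, rfl⟩ := torusChar_surjective y
    have h := torusCharFun_gaussianTorusLine τ x σ v
    unfold torusCharFun at h
    rw [h]
    exact norm_ne_zero_iff.2 (mul_ne_zero (Circle.coe_ne_zero _) (Complex.exp_ne_zero _))
  · intro y
    obtain ⟨v, rfl⟩ := torusChar_surjective y
    simp only [hφ]
    positivity
  · intro y z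
    obtain ⟨u, rfl⟩ := torusChar_surjective y
    obtain ⟨v, rfl⟩ := torusChar_surjective z
    have h1 : torusChar u + torusChar v = torusChar (u + v) := by
      ext x; exact (torusChar_add_apply u v x).symm
    have h2 : torusChar u - torusChar v = torusChar (u + -v) := by
      ext x
      rw [torusChar_add_apply, torusChar_neg_apply, ← sub_eq_add_neg]
      rfl
    rw [h1, h2]
    simp only [hφ, slopeForm_add, slopeForm_neg]
    ring
  · intro y
    obtain ⟨v, rfl⟩ := torusChar_surjective y
    simp only [hφ]
    exact torusCharFun_gaussianTorusLine τ x σ v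

theorem gaussianTorusLine_coset (τ : ℝ) (x : TwoTorus) (σ : NNReal) :
    gaussianTorusLine τ x σ {z | ∃ t : ℝ, z = x + torusLine τ t} = 1 := by
  refine le_antisymm prob_le_one ?_
  have h := Measure.le_map_apply (μ := gaussianReal 0 σ)
    (measurable_add_torusLine τ x).aemeasurable {z | ∃ t : ℝ, z = x + torusLine τ t}
  have h2 : (fun t => x + torusLine τ t) ⁻¹' {z | ∃ t : ℝ, z = x + torusLine τ t} = Set.univ :=
    Set.eq_univ_of_forall fun t => ⟨t, rfl⟩
  rwa [h2, measure_univ] at h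

theorem toCircle_zsmul_half (n : ℤ) :
    (AddCircle.toCircle (n • ((1 / 2 : ℝ) : Torus)) : ℂ) = (-1) ^ n := by
  rw [AddCircle.toCircle_zsmul, AddCircle.toCircle_apply_mk, Circle.coe_zpow, Circle.coe_exp,
    ← Complex.exp_pi_mul_I]
  congr 2
  push_cast
  ring

theorem torusCharFun_dirac (x : TwoTorus) (v : ℤ × ℤ) :
    torusCharFun (Measure.dirac x) v = (AddCircle.toCircle (torusChar v x) : ℂ) :=
  integral_dirac _ _

/-- A `2ℤ²`-periodic function on `ℤ × ℤ` with nonnegative Fourier transform is the characteristic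
function of a distribution on the elements of order two. -/
theorem exists_measure_of_periodic {F : ℤ × ℤ → ℂ} (hF : ∀ h k, F (h + h + k) = F k)
    {a b c : ℝ} (h0 : F 0 = 1) (ha : F (1, 0) = a) (hb : F (0, 1) = b) (hc : F (1, 1) = c)
    (h1 : 0 ≤ 1 + a + b + c) (h2 : 0 ≤ 1 + a - b - c) (h3 : 0 ≤ 1 - a + b - c)
    (h4 : 0 ≤ 1 - a - b + c) :
    ∃ ω : Measure TwoTorus, IsProbabilityMeasure ω ∧ ω {x | x + x = 0} = 1 ∧
      ∀ v, torusCharFun ω v = F v := by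
  let t : Torus := ((1 / 2 : ℝ) : Torus)
  have ht : t + t = 0 := by
    rw [← AddCircle.coe_add]
    norm_num
  let ω : Measure TwoTorus :=
    ENNReal.ofReal ((1 + a + b + c) / 4) • Measure.dirac (0, 0) +
    ENNReal.ofReal ((1 + a - b - c) / 4) • Measure.dirac (0, t) +
    ENNReal.ofReal ((1 - a + b - c) / 4) • Measure.dirac (t, 0) +
    ENNReal.ofReal ((1 - a - b + c) / 4) • Measure.dirac (t, t)
  have hω : ∀ s : Set TwoTorus, (0, 0) ∈ s → (0, t) ∈ s → (t, 0) ∈ s → (t, t) ∈ s → ω s = 1 := by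
    intro s k1 k2 k3 k4
    simp only [ω, Measure.add_apply, Measure.smul_apply, smul_eq_mul,
      Measure.dirac_apply_of_mem k1, Measure.dirac_apply_of_mem k2, Measure.dirac_apply_of_mem k3,
      Measure.dirac_apply_of_mem k4, mul_one]
    rw [← ENNReal.ofReal_add (by positivity) (by positivity),
      ← ENNReal.ofReal_add (by positivity) (by positivity),
      ← ENNReal.ofReal_add (by positivity) (by positivity), ENNReal.ofReal_eq_one]
    ring
  refine ⟨ω, ⟨hω _ trivial trivial trivial trivial⟩, hω _ ?_ ?_ ?_ ?_, ?_⟩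
  · simp
  · simp [ht]
  · simp [ht]
  · simp [ht]
  intro v
  have key : torusCharFun ω v = ((1 + a + b + c) / 4 : ℝ) +
      ((1 + a - b - c) / 4 : ℝ) * (-1) ^ v.2 + ((1 - a + b - c) / 4 : ℝ) * (-1) ^ v.1 +
      ((1 - a - b + c) / 4 : ℝ) * ((-1) ^ v.1 * (-1) ^ v.2) := by
    have hi : ∀ (x : TwoTorus) (w : ℝ), Integrable
        (fun x => (AddCircle.toCircle (torusChar v x) : ℂ))
        (ENNReal.ofReal w • Measure.dirac x) := fun x w =>
      (integrable_toCircle_char _ _).smul_measure ENNReal.ofReal_ne_top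
    unfold torusCharFun charFun'
    rw [integral_add_measure (((hi _ _).add_measure (hi _ _)).add_measure (hi _ _)) (hi _ _),
      integral_add_measure ((hi _ _).add_measure (hi _ _)) (hi _ _),
      integral_add_measure (hi _ _) (hi _ _)]
    simp only [integral_smul_measure, integral_dirac]
    rw [ENNReal.toReal_ofReal (by positivity), ENNReal.toReal_ofReal (by positivity),
      ENNReal.toReal_ofReal (by positivity), ENNReal.toReal_ofReal (by positivity)]
    simp only [torusChar_apply, smul_zero, zero_add, add_zero, AddCircle.toCircle_zero,
      AddCircle.toCircle_add, Circle.coe_mul, Circle.coe_one, t, toCircle_zsmul_half]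
    simp only [Complex.real_smul, mul_one]
  rw [key]
  obtain ⟨m, n⟩ := v
  have hper : ∀ i j i' j' : ℤ, F (i + i + i', j + j + j') = F (i', j') := fun i j i' j' =>
    hF (i, j) (i', j')
  rcases Int.even_or_odd' m with ⟨i, rfl | rfl⟩ <;> rcases Int.even_or_odd' n with ⟨j, rfl | rfl⟩
  · have := hper i j 0 0
    simp only [add_zero, ← two_mul] at this
    rw [this, ← Prod.zero_eq_mk, h0]
    simp only [zpow_mul]
    norm_num
    ring
  · have := hper i j 0 1
    simp only [add_zero, ← two_mul] at this
    rw [this, hb]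
    simp only [zpow_mul, zpow_add₀ (neg_ne_zero.2 (one_ne_zero' ℂ))]
    norm_num
    ring
  · have := hper i j 1 0
    simp only [add_zero, ← two_mul] at this
    rw [this, ha]
    simp only [zpow_mul, zpow_add₀ (neg_ne_zero.2 (one_ne_zero' ℂ))]
    norm_num
    ring
  · have := hper i j 1 1
    simp only [← two_mul] at this
    rw [this, hc]
    simp only [zpow_mul, zpow_add₀ (neg_ne_zero.2 (one_ne_zero' ℂ))]
    norm_num
    ring

/-- The modulus of continuity of a characteristic function at a point where its modulus is close
to one. -/
theorem norm_torusCharFun_add_sub_le (μ : Measure TwoTorus) [IsProbabilityMeasure μ] (a b : ℤ × ℤ)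
    (hb : torusCharFun μ b ≠ 0) {δ : ℝ} (hδ : 0 < δ) :
    ‖torusCharFun μ (a + b) - torusCharFun μ b / ‖torusCharFun μ b‖ * torusCharFun μ a‖ ≤
      δ / 2 + (1 - ‖torusCharFun μ b‖) / δ := by
  set f := torusCharFun μ
  set c : ℂ := f b / ‖f b‖ with hc
  have hb' : (‖f b‖ : ℂ) ≠ 0 := by exact_mod_cast norm_ne_zero_iff.2 hb
  have hc1 : ‖c‖ = 1 := by
    rw [hc, norm_div, Complex.norm_real, norm_norm, div_self (norm_ne_zero_iff.2 hb)]
  have hfc : f b * (starRingEnd ℂ) c = ‖f b‖ := by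
    rw [hc, map_div₀, Complex.conj_ofReal, ← mul_div_assoc, Complex.mul_conj,
      Complex.normSq_eq_norm_sq, div_eq_iff hb']
    push_cast
    ring
  let z : ℤ × ℤ → TwoTorus → ℂ := fun v x => (AddCircle.toCircle (torusChar v x) : ℂ)
  have hz : ∀ v, Integrable (z v) μ := fun v => integrable_toCircle_char μ _
  have hzn : ∀ v x, ‖z v x‖ = 1 := fun v x => Circle.norm_coe _
  have hzadd : ∀ x, z (a + b) x = z a x * z b x := fun x => by
    simp only [z, torusChar_add_apply, AddCircle.toCircle_add, Circle.coe_mul]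
  have h1 : f (a + b) - c * f a = ∫ x, (z (a + b) x - c * z a x) ∂μ := by
    rw [integral_sub (hz _) ((hz _).const_mul _), integral_const_mul]
    rfl
  have h2 : ∀ x, ‖z (a + b) x - c * z a x‖ ≤
      δ / 2 + (1 - (z b x * (starRingEnd ℂ) c).re) / δ := by
    intro x
    have e1 : ‖z (a + b) x - c * z a x‖ = ‖z b x - c‖ := by
      rw [hzadd, mul_comm (z a x), ← sub_mul, norm_mul, hzn, mul_one]
    have e2 : ‖z b x - c‖ ^ 2 = 2 - 2 * (z b x * (starRingEnd ℂ) c).re := by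
      rw [← Complex.normSq_eq_norm_sq, Complex.normSq_sub, Complex.normSq_eq_norm_sq,
        Complex.normSq_eq_norm_sq, hzn, hc1]
      norm_num
    have e3 : (z b x * (starRingEnd ℂ) c).re = 1 - ‖z b x - c‖ ^ 2 / 2 := by linarith
    rw [e1, e3]
    have e4 : δ / 2 + (1 - (1 - ‖z b x - c‖ ^ 2 / 2)) / δ - ‖z b x - c‖ =
        (‖z b x - c‖ - δ) ^ 2 / (2 * δ) := by
      field_simp
      ring
    have e5 : 0 ≤ (‖z b x - c‖ - δ) ^ 2 / (2 * δ) := by positivity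
    linarith
  have hi : Integrable (fun x => z b x * (starRingEnd ℂ) c) μ := (hz b).mul_const _
  have hi' : Integrable (fun x => (z b x * (starRingEnd ℂ) c).re) μ := hi.re
  have h3 : ∫ x, (z b x * (starRingEnd ℂ) c).re ∂μ = ‖f b‖ := by
    have e1 : ∫ x, (z b x * (starRingEnd ℂ) c).re ∂μ = (∫ x, z b x * (starRingEnd ℂ) c ∂μ).re :=
      integral_re hi
    rw [e1, integral_mul_const]
    change (f b * (starRingEnd ℂ) c).re = _
    rw [hfc, Complex.ofReal_re]
  rw [h1]
  refine (norm_integral_le_integral_norm _).trans ?_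
  have hint : Integrable (fun x => (1 - (z b x * (starRingEnd ℂ) c).re) / δ) μ :=
    ((integrable_const _).sub hi').div_const _
  refine (integral_mono ((hz _).sub ((hz _).const_mul _)).norm
    ((integrable_const (δ / 2)).add hint) h2).trans ?_
  rw [integral_add' (integrable_const _) hint, integral_const,
    integral_div δ fun x => 1 - (z b x * (starRingEnd ℂ) c).re,
    integral_sub (integrable_const _) hi', h3]
  simp

theorem IsHeydeSolution.norm_double {f : ℤ × ℤ → ℂ} (hf : IsHeydeSolution f) (h : ℤ × ℤ) :
    ‖f (h + h)‖ = Real.exp (-logDefect f h h) := by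
  rw [← hf.log_norm_double, Real.exp_log (norm_pos_iff.2 (hf.ne_zero _))]

/-- If the form `logDefect` has irrational kernel, then the defect of multiplicativity of a
characteristic function is positive. -/
theorem doublingDefect_eq_exp {μ : Measure TwoTorus} [IsProbabilityMeasure μ]
    (hf : IsHeydeSolution (torusCharFun μ)) {τ s : ℝ} (hτ : Irrational τ) (hs : 0 ≤ s)
    (hB : ∀ h k, logDefect (torusCharFun μ) h k = s * slopeForm τ h * slopeForm τ k)
    (h k : ℤ × ℤ) :
    doublingDefect (torusCharFun μ) h k =
      ((Real.exp (-(s * slopeForm τ h * slopeForm τ k)) : ℝ) : ℂ) := by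
  set f := torusCharFun μ
  have hre : ∀ h k, ∃ d : ℝ, doublingDefect f h k = d ∧ d ≠ 0 := by
    intro h k
    obtain ⟨d, hd⟩ := Complex.conj_eq_iff_real.1 (hf.conj_doublingDefect h k)
    refine ⟨d, hd, fun h0 => hf.doublingDefect_ne_zero h k ?_⟩
    rw [hd, h0, Complex.ofReal_zero]
  obtain ⟨d, hd, hd0⟩ := hre h k
  have habs : |d| = Real.exp (-(s * slopeForm τ h * slopeForm τ k)) := by
    rw [← hB, logDefect, neg_neg, Real.exp_log (norm_pos_iff.2 (hf.doublingDefect_ne_zero _ _)),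
      hd, Complex.norm_real, Real.norm_eq_abs]
  rw [hd, ← habs]
  congr 1
  refine (abs_of_pos (lt_of_le_of_ne' (not_lt.1 fun hneg => ?_) hd0)).symm
  have hδ : 0 < ‖f k‖ := norm_pos_iff.2 (hf.ne_zero _)
  obtain ⟨m, hm⟩ := exists_abs_linearForm_lt hτ h
    (show 0 < ‖f k‖ / (2 * (s + 1)) by positivity)
  obtain ⟨e, he, he0⟩ := hre m k
  set h' := h + (m + m)
  have hw : |slopeForm τ h'| < ‖f k‖ / (2 * (s + 1)) := hm
  have hD : doublingDefect f h' k = ((d * (e * e) : ℝ) : ℂ) := by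
    rw [hf.doublingDefect_add_left, hf.doublingDefect_add_left, hd, he]
    push_cast
    rfl
  have hde : d * (e * e) < 0 := mul_neg_of_neg_of_pos hneg (mul_self_pos.2 he0)
  have hb0 := hf.ne_zero (h' + h')
  have hbn : (‖f (h' + h')‖ : ℂ) ≠ 0 := by exact_mod_cast norm_ne_zero_iff.2 hb0
  have h1 := norm_torusCharFun_add_sub_le μ k (h' + h') hb0 hδ
  change ‖f (k + (h' + h')) - f (h' + h') / ‖f (h' + h')‖ * f k‖ ≤
    ‖f k‖ / 2 + (1 - ‖f (h' + h')‖) / ‖f k‖ at h1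
  have h2 : f (k + (h' + h')) - f (h' + h') / ‖f (h' + h')‖ * f k =
      f (h' + h') / ‖f (h' + h')‖ * f k * ((‖f (h' + h')‖ * (d * (e * e)) - 1 : ℝ) : ℂ) := by
    rw [add_comm k, hf.apply_add, hD]
    push_cast
    field_simp
  rw [h2, norm_mul, norm_mul, norm_div, Complex.norm_real, norm_norm,
    div_self (norm_ne_zero_iff.2 hb0), one_mul, Complex.norm_real, Real.norm_eq_abs] at h1
  have h3 : 1 ≤ |‖f (h' + h')‖ * (d * (e * e)) - 1| := by
    have := mul_nonpos_of_nonneg_of_nonpos (norm_nonneg (f (h' + h'))) hde.le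
    rw [abs_of_neg (by linarith)]
    linarith
  have h4 : 1 - ‖f (h' + h')‖ ≤ s * slopeForm τ h' ^ 2 := by
    rw [hf.norm_double, hB]
    have := Real.add_one_le_exp (-(s * slopeForm τ h' * slopeForm τ h'))
    nlinarith
  have h5 : ‖f k‖ ≤ ‖f k‖ / 2 + (1 - ‖f (h' + h')‖) / ‖f k‖ :=
    (le_mul_of_one_le_right hδ.le h3).trans h1
  have h6 : ‖f k‖ / 2 * ‖f k‖ ≤ 1 - ‖f (h' + h')‖ := by
    rw [← le_div_iff₀ hδ]
    linarith
  have h7 : |slopeForm τ h'| * (s + 1) < ‖f k‖ / 2 := by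
    rw [lt_div_iff₀ (by positivity)] at hw
    linarith
  have h8 : slopeForm τ h' ^ 2 = |slopeForm τ h'| ^ 2 := (sq_abs _).symm
  have h9 : (|slopeForm τ h'| * (s + 1)) ^ 2 ≤ (‖f k‖ / 2) ^ 2 :=
    pow_le_pow_left₀ (by positivity) h7.le 2
  have h10 : s * |slopeForm τ h'| ^ 2 ≤ (|slopeForm τ h'| * (s + 1)) ^ 2 := by
    nlinarith [sq_nonneg (|slopeForm τ h'|), mul_nonneg hs (sq_nonneg (|slopeForm τ h'|)),
      mul_nonneg hs (mul_nonneg hs (sq_nonneg (|slopeForm τ h'|)))]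
  nlinarith [mul_pos hδ hδ]

theorem torusCharFun_re_sum_nonneg (μ : Measure TwoTorus) [IsProbabilityMeasure μ] (u v : ℤ × ℤ)
    {σ₁ σ₂ : ℝ} (h₁ : |σ₁| ≤ 1) (h₂ : |σ₂| ≤ 1) :
    0 ≤ 1 + σ₁ * (torusCharFun μ u).re + σ₂ * (torusCharFun μ v).re +
      σ₁ * σ₂ / 2 * ((torusCharFun μ (u + v)).re + (torusCharFun μ (u - v)).re) := by
  let z : ℤ × ℤ → TwoTorus → ℂ := fun v x => (AddCircle.toCircle (torusChar v x) : ℂ)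
  have hz : ∀ v, Integrable (z v) μ := fun v => integrable_toCircle_char μ _
  have hzr : ∀ v, Integrable (fun x => (z v x).re) μ := fun v => (hz v).re
  have hre : ∀ v, (torusCharFun μ v).re = ∫ x, (z v x).re ∂μ := fun v => (integral_re (hz v)).symm
  have hle : ∀ v x, |(z v x).re| ≤ 1 := fun v x =>
    (Complex.abs_re_le_norm _).trans (Circle.norm_coe _).le
  have hpt : ∀ x, 0 ≤ 1 + σ₁ * (z u x).re + σ₂ * (z v x).re +
      σ₁ * σ₂ / 2 * ((z (u + v) x).re + (z (u - v) x).re) := by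
    intro x
    have e1 : z (u + v) x = z u x * z v x := by
      simp only [z, torusChar_add_apply, AddCircle.toCircle_add, Circle.coe_mul]
    have e2 : z (u - v) x = z u x * (starRingEnd ℂ) (z v x) := by
      simp only [z, sub_eq_add_neg, torusChar_add_apply, torusChar_neg_apply,
        AddCircle.toCircle_add, AddCircle.toCircle_neg, Circle.coe_mul, Circle.coe_inv_eq_conj]
    have e3 : ∀ {σ : ℝ} v, |σ| ≤ 1 → 0 ≤ 1 + σ * (z v x).re := by
      intro σ v hσ
      have := mul_le_one₀ hσ (abs_nonneg _) (hle v x)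
      rw [← abs_mul] at this
      linarith [(abs_le.1 this).1]
    have e4 := mul_nonneg (e3 u h₁) (e3 v h₂)
    rw [e1, e2]
    simp only [Complex.mul_re, Complex.conj_re, Complex.conj_im]
    linarith
  have h : 0 ≤ ∫ x, (1 + σ₁ * (z u x).re + σ₂ * (z v x).re +
      σ₁ * σ₂ / 2 * ((z (u + v) x).re + (z (u - v) x).re)) ∂μ := integral_nonneg hpt
  have i₁ : Integrable (fun x => 1 + σ₁ * (z u x).re) μ :=
    (integrable_const _).add ((hzr u).const_mul σ₁)
  have i₂ : Integrable (fun x => 1 + σ₁ * (z u x).re + σ₂ * (z v x).re) μ :=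
    i₁.add ((hzr v).const_mul σ₂)
  have i₃ : Integrable (fun x => (z (u + v) x).re + (z (u - v) x).re) μ := (hzr _).add (hzr _)
  rw [integral_add i₂ (i₃.const_mul _), integral_add i₁ ((hzr v).const_mul σ₂),
    integral_add (integrable_const _) ((hzr u).const_mul σ₁), integral_const_mul,
    integral_const_mul, integral_const_mul, integral_add (hzr _) (hzr _)] at h
  simpa only [hre, integral_const, probReal_univ, one_smul] using h

/-- Every homomorphism from `ℤ × ℤ` to the circle group is the evaluation at the double of a
point of the two-dimensional torus. -/
theorem exists_torusChar_add_self_eq (c : ℤ × ℤ →+ Torus) :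
    ∃ x : TwoTorus, ∀ v, torusChar v x + torusChar v x = c v := by
  have half : ∀ y : Torus, ∃ x : Torus, x + x = y := by
    intro y
    obtain ⟨r, rfl⟩ := QuotientAddGroup.mk_surjective y
    exact ⟨((r / 2 : ℝ) : Torus), by rw [← AddCircle.coe_add, add_halves]⟩
  obtain ⟨x₁, h₁⟩ := half (c (1, 0))
  obtain ⟨x₂, h₂⟩ := half (c (0, 1))
  refine ⟨(x₁, x₂), fun v => ?_⟩
  have hv : v = v.1 • ((1, 0) : ℤ × ℤ) + v.2 • ((0, 1) : ℤ × ℤ) := by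
    ext <;> simp
  conv_rhs => rw [hv, map_add, map_zsmul, map_zsmul, ← h₁, ← h₂]
  simp only [torusChar_apply, smul_add]
  abel

theorem exists_toCircle_eq {z : ℂ} (hz : ‖z‖ = 1) :
    ∃ t : Torus, (AddCircle.toCircle t : ℂ) = z := by
  obtain ⟨t, ht⟩ := (AddCircle.homeomorphCircle one_ne_zero).surjective
    (⟨z, mem_sphere_zero_iff_norm.2 hz⟩ : Circle)
  rw [AddCircle.homeomorphCircle_apply] at ht
  exact ⟨t, by rw [ht]⟩

section GaussianDecomposition

variable {μ : Measure TwoTorus} [IsProbabilityMeasure μ] {τ s : ℝ}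

/-- The even values of a characteristic function with positive defect of multiplicativity are
those of a Gaussian distribution. -/
theorem exists_torusCharFun_double_eq (hf : IsHeydeSolution (torusCharFun μ)) (hτ : Irrational τ)
    (hs : 0 ≤ s)
    (hB : ∀ h k, logDefect (torusCharFun μ) h k = s * slopeForm τ h * slopeForm τ k) :
    ∃ x : TwoTorus, ∀ h, torusCharFun μ (h + h) =
      (AddCircle.toCircle (torusChar (h + h) x) : ℂ) *
        ((Real.exp (-(s * slopeForm τ h ^ 2)) : ℝ) : ℂ) := by
  have hex : ∀ h, ∃ t : Torus, (AddCircle.toCircle t : ℂ) *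
      ((Real.exp (-(s * slopeForm τ h ^ 2)) : ℝ) : ℂ) = torusCharFun μ (h + h) := by
    intro h
    have hE : ((Real.exp (-(s * slopeForm τ h ^ 2)) : ℝ) : ℂ) ≠ 0 := by
      exact_mod_cast (Real.exp_pos _).ne'
    obtain ⟨t, ht⟩ := exists_toCircle_eq (z := torusCharFun μ (h + h) /
      ((Real.exp (-(s * slopeForm τ h ^ 2)) : ℝ) : ℂ)) (by
        rw [norm_div, hf.norm_double, hB, Complex.norm_real, Real.norm_eq_abs, Real.abs_exp,
          mul_assoc, ← sq, div_self (Real.exp_pos _).ne'])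
    exact ⟨t, by rw [ht, div_mul_cancel₀ _ hE]⟩
  choose c hc using hex
  have hadd : ∀ h k, c (h + k) = c h + c k := by
    intro h k
    refine AddCircle.injective_toCircle one_ne_zero (Circle.ext ?_)
    have h1 := hf.apply_add h (k + k)
    rw [show h + h + (k + k) = h + k + (h + k) by abel, ← hc, ← hc, ← hc,
      hf.doublingDefect_add_right, doublingDefect_eq_exp hf hτ hs hB] at h1
    refine mul_right_cancel₀ (b := ((Real.exp (-(s * slopeForm τ (h + k) ^ 2)) : ℝ) : ℂ))
      (by exact_mod_cast (Real.exp_pos _).ne') ?_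
    rw [h1, AddCircle.toCircle_add, Circle.coe_mul]
    have h2 : Real.exp (-(s * slopeForm τ (h + k) ^ 2)) =
        Real.exp (-(s * slopeForm τ h ^ 2)) * Real.exp (-(s * slopeForm τ k ^ 2)) *
          (Real.exp (-(s * slopeForm τ h * slopeForm τ k)) *
            Real.exp (-(s * slopeForm τ h * slopeForm τ k))) := by
      rw [← Real.exp_add, ← Real.exp_add, ← Real.exp_add, slopeForm_add]
      congr 1
      ring
    rw [h2]
    push_cast
    ring
  obtain ⟨x, hx⟩ := exists_torusChar_add_self_eq (AddMonoidHom.mk' c hadd)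
  refine ⟨x, fun h => ?_⟩
  rw [torusChar_add_apply, hx, ← hc]
  rfl

/-- A periodic function which becomes a characteristic function after multiplication by
arbitrarily slowly decaying Gaussian factors is a characteristic function. -/
theorem exists_measure_of_periodic_mul_exp (hτ : Irrational τ) {F : ℤ × ℤ → ℂ}
    (hF : ∀ h k, F (h + h + k) = F k)
    (hμ : ∀ v, torusCharFun μ v = F v * ((Real.exp (-(s * slopeForm τ v ^ 2)) : ℝ) : ℂ)) :
    ∃ ω : Measure TwoTorus, IsProbabilityMeasure ω ∧ ω {x | x + x = 0} = 1 ∧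
      ∀ v, torusCharFun ω v = F v := by
  have hreal : ∀ v, F v = ((F v).re : ℂ) := by
    intro v
    have h1 := torusCharFun_neg μ v
    rw [hμ, hμ, slopeForm_neg, neg_sq, map_mul, Complex.conj_ofReal] at h1
    have h2 := mul_right_cancel₀ (by exact_mod_cast (Real.exp_pos _).ne') h1
    have h3 := hF (-v) v
    rw [show -v + -v + v = -v by abel] at h3
    exact (Complex.conj_eq_iff_re.1 (h2.symm.trans h3)).symm
  have h0 : F 0 = 1 := by
    have h1 := hμ 0
    rw [torusCharFun_zero] at h1
    simpa [slopeForm] using h1.symm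
  have hμre : ∀ v, (torusCharFun μ v).re = (F v).re * Real.exp (-(s * slopeForm τ v ^ 2)) := by
    intro v
    rw [hμ, Complex.re_mul_ofReal]
  have hseq : ∀ c : ℤ × ℤ, ∃ h : ℕ → ℤ × ℤ,
      Tendsto (fun n => slopeForm τ (h n + h n + c)) atTop (𝓝 0) := by
    intro c
    have h1 : ∀ n : ℕ, ∃ h : ℤ × ℤ, |slopeForm τ (h + h + c)| < 1 / ((n : ℝ) + 1) := by
      intro n
      obtain ⟨h, hh⟩ := exists_abs_linearForm_lt hτ c (ε := 1 / ((n : ℝ) + 1)) (by positivity)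
      exact ⟨h, by rw [add_comm]; exact hh⟩
    choose h hh using h1
    exact ⟨h, squeeze_zero_norm (fun n => (hh n).le) tendsto_one_div_add_atTop_nhds_zero_nat⟩
  obtain ⟨h, hh⟩ := hseq (1, 0)
  obtain ⟨k, hk⟩ := hseq (0, 1)
  have hlim : ∀ {w : ℕ → ℝ} (a : ℝ), Tendsto w atTop (𝓝 0) →
      Tendsto (fun n => a * Real.exp (-(s * w n ^ 2))) atTop (𝓝 a) := by
    intro w a hw
    have h1 : Continuous fun t : ℝ => a * Real.exp (-(s * t ^ 2)) := by fun_prop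
    simpa [Function.comp_def] using (h1.tendsto 0).comp hw
  have key : ∀ {σ₁ σ₂ : ℝ}, |σ₁| ≤ 1 → |σ₂| ≤ 1 →
      0 ≤ 1 + σ₁ * (F (1, 0)).re + σ₂ * (F (0, 1)).re +
        σ₁ * σ₂ / 2 * ((F (1, 1)).re + (F (1, 1)).re) := by
    intro σ₁ σ₂ h₁ h₂
    refine ge_of_tendsto' (x := atTop) (f := fun n : ℕ => _) ?_ fun n =>
      torusCharFun_re_sum_nonneg μ (h n + h n + (1, 0)) (k n + k n + (0, 1)) h₁ h₂
    simp only [hμre]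
    have e1 : ∀ n, F (h n + h n + (1, 0) + (k n + k n + (0, 1))) = F (1, 1) := by
      intro n
      rw [show h n + h n + (1, 0) + (k n + k n + (0, 1)) =
        (h n + k n) + (h n + k n) + (1, 1) by ext <;> simp <;> ring, hF]
    have e2 : ∀ n, F (h n + h n + (1, 0) - (k n + k n + (0, 1))) = F (1, 1) := by
      intro n
      rw [show h n + h n + (1, 0) - (k n + k n + (0, 1)) =
        (h n - k n - (0, 1)) + (h n - k n - (0, 1)) + (1, 1) by ext <;> simp <;> ring, hF]
    simp only [e1, e2, hF]
    have hadd := hh.add hk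
    have hsub := hh.sub hk
    rw [add_zero] at hadd
    rw [sub_zero] at hsub
    refine (((hlim _ hh).const_mul σ₁).const_add 1 |>.add ((hlim _ hk).const_mul σ₂)).add
      ((Tendsto.add (hlim _ ?_) (hlim _ ?_)).const_mul _)
    · simpa only [slopeForm_add τ (h _ + h _ + (1, 0))] using hadd
    · simpa only [sub_eq_add_neg, slopeForm_add τ (h _ + h _ + (1, 0)), slopeForm_neg] using hsub
  have k1 := key (σ₁ := 1) (σ₂ := 1) (by simp) (by simp)
  have k2 := key (σ₁ := 1) (σ₂ := -1) (by simp) (by simp)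
  have k3 := key (σ₁ := -1) (σ₂ := 1) (by simp) (by simp)
  have k4 := key (σ₁ := -1) (σ₂ := -1) (by simp) (by simp)
  exact exists_measure_of_periodic hF h0 (hreal _) (hreal _) (hreal _) (by linarith)
    (by linarith) (by linarith) (by linarith)

/-- A distribution whose characteristic function has defect of multiplicativity given by a form
of rank one and irrational slope is the convolution of a Gaussian distribution and a distribution
on the elements of order two. -/
theorem exists_eq_gaussianTorusLine_conv (hf : IsHeydeSolution (torusCharFun μ))
    (hτ : Irrational τ) (hs : 0 ≤ s)
    (hB : ∀ h k, logDefect (torusCharFun μ) h k = s * slopeForm τ h * slopeForm τ k) :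
    ∃ (x : TwoTorus) (σ : NNReal) (ω : Measure TwoTorus), IsProbabilityMeasure ω ∧
      ω {x | x + x = 0} = 1 ∧ μ = gaussianTorusLine τ x σ ∗ ω := by
  obtain ⟨x, hx⟩ := exists_torusCharFun_double_eq hf hτ hs hB
  let ν : Measure TwoTorus := μ ∗ Measure.dirac (-x)
  have hinv : ∀ v, (AddCircle.toCircle (torusChar v x) : ℂ) *
      (AddCircle.toCircle (torusChar v (-x)) : ℂ) = 1 := by
    intro v
    rw [← Circle.coe_mul, ← AddCircle.toCircle_add, ← map_add, add_neg_cancel]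
    simp
  let F : ℤ × ℤ → ℂ := fun v => torusCharFun μ v *
    (AddCircle.toCircle (torusChar v (-x)) : ℂ) * ((Real.exp (s / 4 * slopeForm τ v ^ 2) : ℝ) : ℂ)
  have hEE : ∀ t : ℝ, ((Real.exp t : ℝ) : ℂ) * ((Real.exp (-t) : ℝ) : ℂ) = 1 := by
    intro t
    rw [← Complex.ofReal_mul, ← Real.exp_add, add_neg_cancel, Real.exp_zero, Complex.ofReal_one]
  have hF : ∀ h k, F (h + h + k) = F k := by
    intro h k
    simp only [F]
    rw [hf.apply_add, hx, doublingDefect_eq_exp hf hτ hs hB, torusChar_add_apply (h + h) k,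
      AddCircle.toCircle_add, Circle.coe_mul]
    have h2 : Real.exp (s / 4 * slopeForm τ (h + h + k) ^ 2) =
        Real.exp (s * slopeForm τ h ^ 2) * Real.exp (s * slopeForm τ h * slopeForm τ k) *
          Real.exp (s / 4 * slopeForm τ k ^ 2) := by
      rw [← Real.exp_add, ← Real.exp_add, slopeForm_add, slopeForm_add]
      congr 1
      ring
    rw [h2, Complex.ofReal_mul, Complex.ofReal_mul]
    have h3 := hEE (s * slopeForm τ h ^ 2)
    have h4 := hEE (s * slopeForm τ h * slopeForm τ k)
    have h5 := hinv (h + h)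
    generalize ((Real.exp (s * slopeForm τ h ^ 2) : ℝ) : ℂ) = A at *
    generalize ((Real.exp (-(s * slopeForm τ h ^ 2)) : ℝ) : ℂ) = A' at *
    generalize ((Real.exp (s * slopeForm τ h * slopeForm τ k) : ℝ) : ℂ) = B at *
    generalize ((Real.exp (-(s * slopeForm τ h * slopeForm τ k)) : ℝ) : ℂ) = B' at *
    generalize (AddCircle.toCircle (torusChar (h + h) x) : ℂ) = C at *
    generalize (AddCircle.toCircle (torusChar (h + h) (-x)) : ℂ) = C' at *
    have h6 : (A * A') * (B * B') * (C * C') = 1 := by rw [h3, h4, h5]; norm_num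
    linear_combination (torusCharFun μ k * (AddCircle.toCircle (torusChar k (-x)) : ℂ) *
      ((Real.exp (s / 4 * slopeForm τ k ^ 2) : ℝ) : ℂ)) * h6
  have hν : ∀ v, torusCharFun ν v =
      F v * ((Real.exp (-(s / 4 * slopeForm τ v ^ 2)) : ℝ) : ℂ) := by
    intro v
    simp only [F, ν]
    rw [torusCharFun_conv, torusCharFun_dirac, mul_assoc _ ((Real.exp _ : ℝ) : ℂ), hEE, mul_one]
  obtain ⟨ω, hω, hω2, hωF⟩ := exists_measure_of_periodic_mul_exp hτ hF hν
  obtain ⟨σ, hσ⟩ : ∃ σ : NNReal, (σ : ℝ) = s / (8 * Real.pi ^ 2) :=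
    ⟨⟨s / (8 * Real.pi ^ 2), by positivity⟩, rfl⟩
  refine ⟨x, σ, ω, hω, hω2, ext_of_torusCharFun fun v => ?_⟩
  rw [torusCharFun_conv, hωF, torusCharFun_gaussianTorusLine]
  have h1 : 2 * Real.pi ^ 2 * σ * slopeForm τ v ^ 2 = s / 4 * slopeForm τ v ^ 2 := by
    rw [hσ]
    field_simp
    ring
  rw [h1, ← Complex.ofReal_neg, ← Complex.ofReal_exp]
  have h2 := hEE (s / 4 * slopeForm τ v ^ 2)
  have h3 := hinv v
  simp only [F]
  linear_combination (-torusCharFun μ v * (AddCircle.toCircle (torusChar v x) : ℂ) *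
    (AddCircle.toCircle (torusChar v (-x)) : ℂ)) * h2 - torusCharFun μ v * h3

end GaussianDecomposition

/-- The adjoint of a continuous endomorphism of the two-dimensional torus. -/
theorem exists_torusChar_adjoint (φ : TwoTorus →+ TwoTorus) (hφ : Continuous φ) :
    ∃ A : ℤ × ℤ →+ ℤ × ℤ, ∀ v x, torusChar (A v) x = torusChar v (φ x) := by
  have h : ∀ v, ∃ w, ∀ x, torusChar w x = torusChar v (φ x) := by
    intro v
    obtain ⟨w, hw⟩ := torusChar_surjective ((torusChar v).comp ⟨φ, hφ⟩)
    exact ⟨w, fun x => by rw [hw]; rfl⟩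
  choose A hA using h
  refine ⟨AddMonoidHom.mk' A fun u v => torusChar_injective ?_, hA⟩
  ext x
  rw [hA, torusChar_add_apply, torusChar_add_apply, hA, hA]

theorem surjective_of_torusChar_adjoint (β : TwoTorus ≃+ TwoTorus) (hβ : Continuous β.symm)
    (A : ℤ × ℤ → ℤ × ℤ) (hA : ∀ v x, torusChar (A v) x = torusChar v (β x)) :
    Function.Surjective A := by
  obtain ⟨B, hB⟩ := exists_torusChar_adjoint β.symm.toAddMonoidHom hβ
  refine fun v => ⟨B v, torusChar_injective ?_⟩
  ext x
  rw [hA, hB]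
  exact congrArg _ (β.symm_apply_apply x)

/-- Symmetry of the conditional distribution of one linear form given another one implies the
Heyde functional equation. -/
theorem heyde_functional_equation {Ω : Type*} [MeasurableSpace Ω] {P : Measure Ω}
    [IsProbabilityMeasure P] {ξ₁ ξ₂ : Ω → TwoTorus} (hξ₁ : Measurable ξ₁) (hξ₂ : Measurable ξ₂)
    (hind : IndepFun ξ₁ ξ₂ P) {α : TwoTorus → TwoTorus} (hα : Continuous α)
    (hsym : P.map (fun ω => (ξ₁ ω + ξ₂ ω, ξ₁ ω + α (ξ₂ ω)))
          = P.map (fun ω => (ξ₁ ω + ξ₂ ω, -(ξ₁ ω + α (ξ₂ ω)))))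
    (A : ℤ × ℤ → ℤ × ℤ) (hA : ∀ v x, torusChar (A v) x = torusChar v (α x)) (u v : ℤ × ℤ) :
    torusCharFun (P.map ξ₁) (u + v) * torusCharFun (P.map ξ₂) (u + A v) =
      torusCharFun (P.map ξ₁) (u - v) * torusCharFun (P.map ξ₂) (u - A v) := by
  have hmul : ∀ a b : ℤ × ℤ, torusCharFun (P.map ξ₁) a * torusCharFun (P.map ξ₂) b =
      ∫ ω, (AddCircle.toCircle (torusChar a (ξ₁ ω)) : ℂ) *
        (AddCircle.toCircle (torusChar b (ξ₂ ω)) : ℂ) ∂P := by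
    intro a b
    have ha := continuous_toCircle_char (torusChar a)
    have hb := continuous_toCircle_char (torusChar b)
    unfold torusCharFun charFun'
    rw [integral_map hξ₁.aemeasurable ha.aestronglyMeasurable,
      integral_map hξ₂.aemeasurable hb.aestronglyMeasurable]
    exact (hind.integral_fun_comp_mul_comp hξ₁.aemeasurable hξ₂.aemeasurable
      ha.aestronglyMeasurable hb.aestronglyMeasurable).symm
  have hαm := hα.measurable
  have h1 : Measurable fun ω => (ξ₁ ω + ξ₂ ω, ξ₁ ω + α (ξ₂ ω)) := by fun_prop
  have h2 : Measurable fun ω => (ξ₁ ω + ξ₂ ω, -(ξ₁ ω + α (ξ₂ ω))) := by fun_prop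
  have hΦ : Continuous fun z : TwoTorus × TwoTorus =>
      (AddCircle.toCircle (torusChar u z.1) : ℂ) * (AddCircle.toCircle (torusChar v z.2) : ℂ) :=
    ((continuous_toCircle_char _).comp continuous_fst).mul
      ((continuous_toCircle_char _).comp continuous_snd)
  have h3 := congrArg (fun ν => ∫ z, (AddCircle.toCircle (torusChar u z.1) : ℂ) *
    (AddCircle.toCircle (torusChar v z.2) : ℂ) ∂ν) hsym
  rw [integral_map h1.aemeasurable hΦ.aestronglyMeasurable,
    integral_map h2.aemeasurable hΦ.aestronglyMeasurable] at h3
  rw [hmul, hmul]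
  simp only [← Circle.coe_mul, ← AddCircle.toCircle_add] at h3 ⊢
  convert h3 using 4 with ω ω
  · simp only [torusChar_add_apply, hA, map_add]
    congr 2
    abel
  · simp only [sub_eq_add_neg, torusChar_add_apply, torusChar_neg_apply, hA, map_add, map_neg]
    congr 2
    abel

theorem isHeydeSolution_torusCharFun {μ : Measure TwoTorus} [IsProbabilityMeasure μ]
    (hμ : ∀ v, torusCharFun μ v ≠ 0) {g : ℤ × ℤ → ℂ} (hg : ∀ v, g v ≠ 0)
    {A : ℤ × ℤ → ℤ × ℤ} (hA : ∀ u v, A (u + v) = A u + A v)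
    (hp : ∀ y, ∃ z, z + A z = y) (hm : ∀ y, ∃ z, z - A z = y)
    (h : ∀ u v, torusCharFun μ (u + v) * g (u + A v) = torusCharFun μ (u - v) * g (u - A v)) :
    IsHeydeSolution (torusCharFun μ) where
  ne_zero := hμ
  map_zero := torusCharFun_zero μ
  map_neg := torusCharFun_neg μ
  norm_le_one := norm_torusCharFun_le_one μ
  third_difference k l n := by
    have h1 := heyde_equation_third_difference A hA hp hm
      (fun v => Additive.ofMul (Units.mk0 _ (hμ v))) (fun v => Additive.ofMul (Units.mk0 _ (hg v)))
      (fun u v => congrArg Additive.ofMul (Units.ext (h u v))) k l n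
    have h2 := congrArg (fun m : Additive ℂˣ => ((Additive.toMul m : ℂˣ) : ℂ)) h1
    simpa [torusCharFun_zero] using h2

/-- An integer matrix defining a surjection of `ℤ × ℤ` has determinant `±1`. -/
theorem det_eq_one_or_neg_one_of_surjective {a b c d : ℤ}
    (h : ∀ p q : ℤ, ∃ x y : ℤ, a * x + b * y = p ∧ c * x + d * y = q) :
    a * d - b * c = 1 ∨ a * d - b * c = -1 := by
  obtain ⟨x, y, h1, h2⟩ := h 1 0
  obtain ⟨z, w, h3, h4⟩ := h 0 1
  refine Int.eq_one_or_neg_one_of_mul_eq_one (v := x * w - y * z) ?_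
  linear_combination (c * z + d * w) * h1 - (a * z + b * w) * h2 + h4

theorem int_prod_hom_apply (A : ℤ × ℤ →+ ℤ × ℤ) (v : ℤ × ℤ) :
    A v = ((A (1, 0)).1 * v.1 + (A (0, 1)).1 * v.2, (A (1, 0)).2 * v.1 + (A (0, 1)).2 * v.2) := by
  have hv : v = v.1 • ((1, 0) : ℤ × ℤ) + v.2 • ((0, 1) : ℤ × ℤ) := by
    ext <;> simp
  conv_lhs => rw [hv, map_add, map_zsmul, map_zsmul]
  ext <;> simp <;> ring

/-- If `A`, `I + A` and `I - A` are automorphisms of `ℤ × ℤ`, then `A` has determinant `-1` and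
trace `±1`. -/
theorem det_trace_of_surjective (A : ℤ × ℤ →+ ℤ × ℤ) (hA : Function.Surjective A)
    (hp : ∀ y, ∃ z, z + A z = y) (hm : ∀ y, ∃ z, z - A z = y) :
    (A (1, 0)).1 * (A (0, 1)).2 - (A (0, 1)).1 * (A (1, 0)).2 = -1 ∧
      ((A (1, 0)).1 + (A (0, 1)).2) ^ 2 = 1 := by
  have h1 := int_prod_hom_apply A
  generalize (A (1, 0)).1 = a at *
  generalize (A (0, 1)).1 = b at *
  generalize (A (1, 0)).2 = c at *
  generalize (A (0, 1)).2 = d at *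
  have k1 : a * d - b * c = 1 ∨ a * d - b * c = -1 := by
    refine det_eq_one_or_neg_one_of_surjective fun p q => ?_
    obtain ⟨z, hz⟩ := hA (p, q)
    rw [h1, Prod.mk.injEq] at hz
    exact ⟨z.1, z.2, hz⟩
  have k2 : (1 + a) * (1 + d) - b * c = 1 ∨ (1 + a) * (1 + d) - b * c = -1 := by
    refine det_eq_one_or_neg_one_of_surjective fun p q => ?_
    obtain ⟨z, hz⟩ := hp (p, q)
    rw [h1, Prod.ext_iff] at hz
    simp only [Prod.fst_add, Prod.snd_add] at hz
    exact ⟨z.1, z.2, by linarith [hz.1], by linarith [hz.2]⟩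
  have k3 : (1 - a) * (1 - d) - (-b) * (-c) = 1 ∨ (1 - a) * (1 - d) - (-b) * (-c) = -1 := by
    refine det_eq_one_or_neg_one_of_surjective fun p q => ?_
    obtain ⟨z, hz⟩ := hm (p, q)
    rw [h1, Prod.ext_iff] at hz
    simp only [Prod.fst_sub, Prod.snd_sub] at hz
    exact ⟨z.1, z.2, by linarith [hz.1], by linarith [hz.2]⟩
  ring_nf at k1 k2 k3 ⊢
  have k4 : a * d - b * c = -1 ∧ (a + d = 1 ∨ a + d = -1) := by
    generalize a * d = x at *
    generalize b * c = y at *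
    omega
  refine ⟨k4.1, ?_⟩
  have k5 : a * d * 2 + a ^ 2 + d ^ 2 = (a + d) ^ 2 := by ring
  rw [k5]
  rcases k4.2 with k | k <;> rw [k] <;> norm_num

theorem IsHeydeSolution.logDefect_eq {f : ℤ × ℤ → ℂ} (hf : IsHeydeSolution f) (h k : ℤ × ℤ) :
    logDefect f h k = logDefect f (1, 0) (1, 0) * (h.1 * k.1) +
      logDefect f (1, 0) (0, 1) * (h.1 * k.2 + h.2 * k.1) +
      logDefect f (0, 1) (0, 1) * (h.2 * k.2) := by
  rw [map_int_prod_eq (logDefect f h) (hf.logDefect_add_right h) k,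
    map_int_prod_eq (fun u => logDefect f u (1, 0)) (fun u v => hf.logDefect_add_left u v _) h,
    map_int_prod_eq (fun u => logDefect f u (0, 1)) (fun u v => hf.logDefect_add_left u v _) h,
    hf.logDefect_comm (0, 1) (1, 0)]
  ring

/-- Solutions of the Heyde functional equation have defects of multiplicativity that are
proportional to the square of a common linear form of irrational slope. -/
theorem IsHeydeSolution.exists_slope {f g : ℤ × ℤ → ℂ} (hf : IsHeydeSolution f)
    (hg : IsHeydeSolution g) (A : ℤ × ℤ →+ ℤ × ℤ) (hA : Function.Surjective A)
    (hp : ∀ y, ∃ z, z + A z = y) (hm : ∀ y, ∃ z, z - A z = y)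
    (h : ∀ u v, f (u + v) * g (u + A v) = f (u - v) * g (u - A v)) :
    ∃ τ s s' : ℝ, Irrational τ ∧ 0 ≤ s ∧ 0 ≤ s' ∧
      (∀ h k, logDefect g h k = s * slopeForm τ h * slopeForm τ k) ∧
      ∀ h k, logDefect f h k = s' * slopeForm τ h * slopeForm τ k := by
  obtain ⟨hdet, htr⟩ := det_trace_of_surjective A hA hp hm
  have key : ∀ v u, logDefect f v u =
      -((A v).1 * logDefect g (1, 0) u + (A v).2 * logDefect g (0, 1) u) := by
    intro v u
    rw [hf.logDefect_eq_neg hg A h,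
      map_int_prod_eq (fun v => logDefect g v u) fun v w => hg.logDefect_add_left v w u]
  have hnn : ∀ {F : ℤ × ℤ → ℂ}, IsHeydeSolution F → ∀ m n : ℤ,
      0 ≤ logDefect F (1, 0) (1, 0) * m ^ 2 + 2 * logDefect F (1, 0) (0, 1) * m * n +
        logDefect F (0, 1) (0, 1) * n ^ 2 := by
    intro F hF m n
    have h1 := hF.logDefect_self_nonneg (m, n)
    rw [hF.logDefect_eq] at h1
    linarith
  obtain ⟨τ, s, s', hτ, hs, hs', h1, h2, h3, h4, h5, h6⟩ :=
    exists_irrational_slope hdet htr (p := logDefect g (1, 0) (1, 0))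
      (q := logDefect g (1, 0) (0, 1)) (r := logDefect g (0, 1) (0, 1))
      (p' := logDefect f (1, 0) (1, 0)) (q' := logDefect f (1, 0) (0, 1))
      (r' := logDefect f (0, 1) (0, 1)) (by rw [key, hg.logDefect_comm (0, 1) (1, 0)])
      (by rw [key]) (by rw [hf.logDefect_comm, key, hg.logDefect_comm (0, 1) (1, 0)])
      (by rw [key]) (hnn hg) (hnn hf)
  refine ⟨τ, s, s', hτ, hs, hs', fun h k => ?_, fun h k => ?_⟩
  · rw [hg.logDefect_eq, h1, h2, h3, slopeForm, slopeForm]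
    ring
  · rw [hf.logDefect_eq, h4, h5, h6, slopeForm, slopeForm]
    ring

end TorusHeyde

/-- Heyde theorem on the 2-dimensional torus under the conditions `I±α ∈ Aut(𝕋²)`:
the distributions are convolutions of Gaussian distributions and distributions supported
in `G`, and the Gaussian distributions are concentrated on cosets of one dense
one-parameter subgroup. -/
theorem heyde_two_torus_I_pm_alpha_automorphisms
    -- α is a topological automorphism of 𝕋² such that I+α and I−α are topological
    -- automorphisms as well
    (α : TwoTorus ≃+ TwoTorus) (hαc : Continuous α) (hαc' : Continuous α.symm)
    (hIpα : ∃ β : TwoTorus ≃+ TwoTorus, Continuous β ∧ Continuous β.symm ∧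
      ∀ x : TwoTorus, β x = x + α x)
    (hImα : ∃ β : TwoTorus ≃+ TwoTorus, Continuous β ∧ Continuous β.symm ∧
      ∀ x : TwoTorus, β x = x - α x)
    -- ξ₁, ξ₂ independent random variables with distributions μ₁, μ₂
    {Ω : Type*} [MeasurableSpace Ω] (P : Measure Ω) [IsProbabilityMeasure P]
    (ξ₁ ξ₂ : Ω → TwoTorus) (hmξ₁ : Measurable ξ₁) (hmξ₂ : Measurable ξ₂)
    (hind : IndepFun ξ₁ ξ₂ P)
    (μ₁ μ₂ : Measure TwoTorus) (hμ₁ : P.map ξ₁ = μ₁) (hμ₂ : P.map ξ₂ = μ₂)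
    -- the characteristic functions do not vanish
    (hnv₁ : ∀ y : CharGroup TwoTorus, charFun' μ₁ y ≠ 0)
    (hnv₂ : ∀ y : CharGroup TwoTorus, charFun' μ₂ y ≠ 0)
    -- the conditional distribution of L₂ = ξ₁ + αξ₂ given L₁ = ξ₁ + ξ₂ is symmetric
    (hsym : P.map (fun ω => (ξ₁ ω + ξ₂ ω, ξ₁ ω + α (ξ₂ ω)))
          = P.map (fun ω => (ξ₁ ω + ξ₂ ω, -(ξ₁ ω + α (ξ₂ ω))))) :
    ∃ (γ₁ γ₂ ω₁ ω₂ : Measure TwoTorus) (p : ℝ →+ TwoTorus),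
      IsGaussianMeasure γ₁ ∧ IsGaussianMeasure γ₂ ∧
      IsProbabilityMeasure ω₁ ∧ IsProbabilityMeasure ω₂ ∧
      ω₁ {x : TwoTorus | x + x = 0} = 1 ∧ ω₂ {x : TwoTorus | x + x = 0} = 1 ∧
      μ₁ = γ₁ ∗ ω₁ ∧ μ₂ = γ₂ ∗ ω₂ ∧
      Continuous p ∧ DenseRange p ∧
      (∃ x₁ : TwoTorus, γ₁ {x : TwoTorus | ∃ t : ℝ, x = x₁ + p t} = 1) ∧
      (∃ x₂ : TwoTorus, γ₂ {x : TwoTorus | ∃ t : ℝ, x = x₂ + p t} = 1) := by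
  subst hμ₁ hμ₂
  have := Measure.isProbabilityMeasure_map (μ := P) hmξ₁.aemeasurable
  have := Measure.isProbabilityMeasure_map (μ := P) hmξ₂.aemeasurable
  obtain ⟨A, hA⟩ := exists_torusChar_adjoint α.toAddMonoidHom hαc
  have hA' : ∀ v x, torusChar (A v) x = torusChar v (α x) := hA
  have hAs := surjective_of_torusChar_adjoint α hαc' A hA'
  have hp : ∀ y, ∃ z, z + A z = y := by
    obtain ⟨β, -, hβ, hβα⟩ := hIpα
    refine surjective_of_torusChar_adjoint β hβ (fun z => z + A z) fun v x => ?_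
    rw [torusChar_add_apply, hA', hβα, map_add]
  have hm : ∀ y, ∃ z, z - A z = y := by
    obtain ⟨β, -, hβ, hβα⟩ := hImα
    refine surjective_of_torusChar_adjoint β hβ (fun z => z - A z) fun v x => ?_
    rw [sub_eq_add_neg, torusChar_add_apply, torusChar_neg_apply, hA', hβα, map_sub,
      ← sub_eq_add_neg]
  have heq := heyde_functional_equation hmξ₁ hmξ₂ hind hαc hsym A hA'
  have hf := isHeydeSolution_torusCharFun (fun v => hnv₁ _) (fun v => hnv₂ (torusChar v))
    (map_add A) hp hm heq
  have hg : IsHeydeSolution (torusCharFun (P.map ξ₂)) := by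
    obtain ⟨B, hB⟩ := exists_torusChar_adjoint α.symm.toAddMonoidHom hαc'
    have hBA : ∀ v, B (A v) = v := fun v => torusChar_injective <| by
      ext x
      rw [hB, hA']
      exact congrArg _ (α.apply_symm_apply x)
    have hAB : ∀ v, A (B v) = v := fun v => by
      obtain ⟨w, rfl⟩ := hAs v
      rw [hBA]
    refine isHeydeSolution_torusCharFun (fun v => hnv₂ _) (fun v => hnv₁ (torusChar v))
      (map_add B) (fun y => ?_) (fun y => ?_) fun u v => ?_
    · obtain ⟨z, rfl⟩ := hp y
      exact ⟨A z, by rw [hBA, add_comm]⟩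
    · obtain ⟨z, hz⟩ := hm (-y)
      exact ⟨A z, by rw [hBA, ← neg_sub, hz, neg_neg]⟩
    · have h1 := heq u (B v)
      rw [hAB] at h1
      rw [mul_comm]
      refine h1.trans (mul_comm _ _)
  obtain ⟨τ, s, s', hτ, hs, hs', hBg, hBf⟩ := hf.exists_slope hg A hAs hp hm heq
  obtain ⟨x₁, σ₁, ω₁, hω₁, hω₁G, h₁⟩ := exists_eq_gaussianTorusLine_conv hf hτ hs' hBf
  obtain ⟨x₂, σ₂, ω₂, hω₂, hω₂G, h₂⟩ := exists_eq_gaussianTorusLine_conv hg hτ hs hBg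
  exact ⟨gaussianTorusLine τ x₁ σ₁, gaussianTorusLine τ x₂ σ₂, ω₁, ω₂, torusLine τ,
    isGaussianMeasure_gaussianTorusLine τ x₁ σ₁, isGaussianMeasure_gaussianTorusLine τ x₂ σ₂,
    hω₁, hω₂, hω₁G, hω₂G, h₁, h₂, continuous_torusLine τ, denseRange_line hτ,
    ⟨x₁, gaussianTorusLine_coset τ x₁ σ₁⟩, ⟨x₂, gaussianTorusLine_coset τ x₂ σ₂⟩⟩
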